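/- Let d be a positive integer and let U₁, …, U_d be bounded open subsets of ℝ^d. Then there exist a nonzero vector u ∈ ℝ^d and a real number c such that for every i with 1 ≤ i ≤ d, the Lebesgue measure of U_i ∩ {x : ⟨u, x⟩ > c} equals half the Lebesgue measure of U_i, and the Lebesgue measure of U_i ∩ {x : ⟨u, x⟩ < c} equals half the Lebesgue measure of U_i. -/

import Mathlib

open scoped RealInnerProductSpace
open MeasureTheory

/-! ### Mod 2 cochains on lists of points

A list of points is regarded as an ordered simplex (the empty list being the augmentation), and a
function `List V → ZMod 2` as a cochain. -/

namespace ListCochain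

section Coboundary

variable {V : Type*}

/-- The mod 2 coboundary: the sum of `φ` over all facets of a list. -/
def coboundary : (List V → ZMod 2) → List V → ZMod 2
  | _, [] => 0
  | φ, a :: l => φ l + coboundary (fun t => φ (a :: t)) l

theorem coboundary_cons (φ : List V → ZMod 2) (a : V) (l : List V) :
    coboundary φ (a :: l) = φ l + coboundary (fun t => φ (a :: t)) l := rfl

theorem coboundary_add (φ ψ : List V → ZMod 2) (l : List V) :
    coboundary (fun t => φ t + ψ t) l = coboundary φ l + coboundary ψ l := by
  induction l generalizing φ ψ with
  | nil => simp [coboundary]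
  | cons a l ih => simp only [coboundary_cons, ih]; ring

theorem coboundary_const_mul (c : ZMod 2) (φ : List V → ZMod 2) (l : List V) :
    coboundary (fun t => c * φ t) l = c * coboundary φ l := by
  induction l generalizing φ with
  | nil => simp [coboundary]
  | cons a l ih => simp only [coboundary_cons, ih]; ring

theorem coboundary_zero (l : List V) : coboundary (fun _ => 0) l = 0 := by
  induction l with
  | nil => rfl
  | cons a l ih => rw [coboundary_cons, ih, add_zero]

theorem coboundary_coboundary (φ : List V → ZMod 2) (l : List V) :
    coboundary (coboundary φ) l = 0 := by
  induction l generalizing φ with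
  | nil => rfl
  | cons a l ih =>
    simp only [coboundary_cons, coboundary_add, ih]
    rw [add_zero, CharTwo.add_self_eq_zero]

theorem coboundary_congr {φ ψ : List V → ZMod 2} {l : List V}
    (h : ∀ t, t.Sublist l → t.length + 1 = l.length → φ t = ψ t) :
    coboundary φ l = coboundary ψ l := by
  induction l generalizing φ ψ with
  | nil => rfl
  | cons a l ih =>
    rw [coboundary_cons, coboundary_cons, h l (List.sublist_cons_self a l) rfl]
    congr 1
    exact ih fun t ht hlen => h (a :: t) (ht.cons_cons a) (by simp [hlen])

theorem coboundary_comp_map (g : V → V) (φ : List V → ZMod 2) (l : List V) :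
    coboundary (fun t => φ (t.map g)) l = coboundary φ (l.map g) := by
  induction l generalizing φ with
  | nil => rfl
  | cons a l ih =>
    simp only [List.map_cons, coboundary_cons]
    rw [ih fun t => φ (g a :: t)]

end Coboundary

section Subdivision

variable {V : Type*} [NormedAddCommGroup V] [NormedSpace ℝ V]

/-- The barycenter of a list of points. -/
noncomputable def barycenter (l : List V) : V := (l.length : ℝ)⁻¹ • l.sum

theorem barycenter_map_neg (l : List V) : barycenter (l.map Neg.neg) = -barycenter l := by
  rw [barycenter, barycenter, List.length_map, ← smul_neg, List.sum_neg]

theorem barycenter_mem {K : Set V} (hK : Convex ℝ K) {l : List V} (hl : l ≠ [])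
    (h : ∀ x ∈ l, x ∈ K) : barycenter l ∈ K := by
  induction l with
  | nil => exact absurd rfl hl
  | cons a l ih =>
    rcases eq_or_ne l [] with rfl | hne
    · simpa [barycenter] using h
    · have hpos : (0 : ℝ) < l.length := by exact_mod_cast List.length_pos_iff.2 hne
      have := hK (h a (by simp)) (ih hne fun x hx => h x (by simp [hx]))
        (a := ((l.length : ℝ) + 1)⁻¹) (b := l.length * ((l.length : ℝ) + 1)⁻¹)
        (by positivity) (by positivity) (by field_simp; ring)
      convert this using 1
      simp only [barycenter, List.length_cons, List.sum_cons, Nat.cast_add, Nat.cast_one, smul_add,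
        smul_smul]
      congr 2
      field_simp

theorem norm_sum_sub_length_smul_le {D : ℝ} (v : V) (l : List V) (h : ∀ x ∈ l, dist x v ≤ D) :
    ‖l.sum - (l.length : ℝ) • v‖ ≤ l.length * D := by
  induction l with
  | nil => simp
  | cons a l ih =>
    have h1 := ih fun x hx => h x (by simp [hx])
    have h2 : ‖a - v‖ ≤ D := by rw [← dist_eq_norm]; exact h a (by simp)
    have h3 : (a :: l).sum - ((a :: l).length : ℝ) • v
        = (a - v) + (l.sum - (l.length : ℝ) • v) := by
      simp only [List.sum_cons, List.length_cons, Nat.cast_add, Nat.cast_one, add_smul, one_smul]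
      abel
    rw [h3]
    refine (norm_add_le _ _).trans ?_
    push_cast [List.length_cons]
    linarith

theorem dist_barycenter_le {N : ℕ} {D : ℝ} {l : List V} (hN : l.length ≤ N + 1)
    (h : ∀ x ∈ l, ∀ y ∈ l, dist x y ≤ D) {v : V} (hv : v ∈ l) :
    dist v (barycenter l) ≤ N / (N + 1) * D := by
  obtain ⟨s, t, rfl⟩ := List.append_of_mem hv
  have hD : 0 ≤ D := dist_nonneg.trans (h v hv v hv)
  have hst := norm_sum_sub_length_smul_le (D := D) v (s ++ t) fun x hx =>
    h x (by simp at hx ⊢; tauto) v hv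
  set k : ℝ := ((s ++ t).length : ℝ) with hk
  have hlen : ((s ++ v :: t).length : ℝ) = k + 1 := by simp [hk]; ring
  have hk0 : 0 ≤ k := by positivity
  have hkN : k ≤ N := by
    have : (s ++ t).length ≤ N := by simp at hN ⊢; omega
    rw [hk]
    exact_mod_cast this
  have key : barycenter (s ++ v :: t) - v = (k + 1)⁻¹ • ((s ++ t).sum - k • v) := by
    have hk1 : k + 1 ≠ 0 := by positivity
    rw [barycenter, hlen, eq_inv_smul_iff₀ hk1, smul_sub, smul_inv_smul₀ hk1]
    simp only [List.sum_append, List.sum_cons, add_smul, one_smul]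
    abel
  rw [dist_comm, dist_eq_norm, key, norm_smul, Real.norm_of_nonneg (by positivity)]
  calc (k + 1)⁻¹ * ‖(s ++ t).sum - k • v‖ ≤ (k + 1)⁻¹ * (k * D) := by gcongr
    _ = k / (k + 1) * D := by ring
    _ ≤ N / (N + 1) * D := by
      gcongr ?_ * D
      rw [div_le_div_iff₀ (by positivity) (by positivity)]
      nlinarith

/-- Evaluation of a cochain on the barycentric subdivision of a list of length `n`. -/
noncomputable def subdivide : ℕ → (List V → ZMod 2) → List V → ZMod 2
  | 0, φ, l => φ l
  | n + 1, φ, l => coboundary (subdivide n fun t => φ (barycenter l :: t)) l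

theorem subdivide_succ (n : ℕ) (φ : List V → ZMod 2) (l : List V) :
    subdivide (n + 1) φ l = coboundary (subdivide n fun t => φ (barycenter l :: t)) l := rfl

theorem subdivide_add (n : ℕ) (φ ψ : List V → ZMod 2) (l : List V) :
    subdivide n (fun t => φ t + ψ t) l = subdivide n φ l + subdivide n ψ l := by
  induction n generalizing φ ψ l with
  | zero => rfl
  | succ n ih => simp only [subdivide_succ, ← coboundary_add, ← ih]

theorem subdivide_coboundary (n : ℕ) (φ : List V → ZMod 2) (l : List V) (hl : l.length = n + 1) :
    subdivide (n + 1) (coboundary φ) l = coboundary (subdivide n φ) l := by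
  induction n generalizing φ l with
  | zero =>
    obtain ⟨a, rfl⟩ := List.length_eq_one_iff.1 hl
    simp [subdivide, coboundary]
  | succ n ih =>
    rw [subdivide_succ]
    simp only [coboundary_cons]
    have h1 : ∀ t, subdivide (n + 1)
        (fun t => φ t + coboundary (fun t => φ (barycenter l :: t)) t) t =
        subdivide (n + 1) φ t +
          subdivide (n + 1) (coboundary fun t => φ (barycenter l :: t)) t :=
      fun t => subdivide_add _ _ _ t
    rw [coboundary_congr fun t _ _ => h1 t, coboundary_add,
      coboundary_congr (φ := subdivide (n + 1) (coboundary fun t => φ (barycenter l :: t)))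
        fun t _ ht => ih _ t (by omega), coboundary_coboundary, add_zero]

theorem subdivide_comp_neg (n : ℕ) (φ : List V → ZMod 2) (l : List V) :
    subdivide n (fun t => φ (t.map Neg.neg)) l = subdivide n φ (l.map Neg.neg) := by
  induction n generalizing φ l with
  | zero => rfl
  | succ n ih =>
    rw [subdivide_succ, subdivide_succ, ← coboundary_comp_map, barycenter_map_neg]
    refine coboundary_congr fun t _ _ => ?_
    rw [← ih]
    rfl

theorem subdivide_one_singleton (φ : List V → ZMod 2) (v : V) :
    subdivide 1 φ [v] = φ [v] := by
  simp [subdivide, coboundary, barycenter]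

theorem subdivide_eq_zero {N : ℕ} {D : ℝ} (n : ℕ) (hn : n ≤ N + 1) (φ : List V → ZMod 2)
    (l : List V) (hl : l.length = n) (K : Set V) (hK : Convex ℝ K) (hlK : ∀ x ∈ l, x ∈ K)
    (hlD : ∀ x ∈ l, ∀ y ∈ l, dist x y ≤ D)
    (h : ∀ t : List V, t.length = n → (∀ x ∈ t, x ∈ K) →
      (∀ x ∈ t, ∀ y ∈ t, dist x y ≤ N / (N + 1) * D) → φ t = 0) :
    subdivide n φ l = 0 := by
  induction n generalizing φ l K with
  | zero =>
    obtain rfl := List.length_eq_zero_iff.1 hl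
    exact h [] rfl (by simp) (by simp)
  | succ n ih =>
    have hne : l ≠ [] := List.ne_nil_of_length_pos (by omega)
    obtain ⟨v, hv⟩ := List.exists_mem_of_ne_nil l hne
    have hD : 0 ≤ D := dist_nonneg.trans (hlD v hv v hv)
    rw [subdivide_succ]
    refine (coboundary_congr fun t htl ht => ?_).trans (coboundary_zero l)
    refine ih (by omega) _ t (by omega)
      (K ∩ Metric.closedBall (barycenter l) (N / (N + 1) * D))
      (hK.inter (convex_closedBall _ _))
      (fun x hx => ⟨hlK x (htl.subset hx), ?_⟩)
      (fun x hx y hy => hlD x (htl.subset hx) y (htl.subset hy)) ?_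
    · exact dist_barycenter_le (by omega) hlD (htl.subset hx)
    · intro s hs hsK hsD
      refine h _ (by simp [hs]) ?_ ?_
      · simp only [List.mem_cons, forall_eq_or_imp]
        exact ⟨barycenter_mem hK hne hlK, fun x hx => (hsK x hx).1⟩
      · simp only [List.mem_cons, forall_eq_or_imp, dist_self]
        refine ⟨⟨by positivity, fun x hx => ?_⟩, fun x hx => ⟨(hsK x hx).2, hsD x hx⟩⟩
        rw [dist_comm]
        exact (hsK x hx).2

/-- Evaluation of a cochain on the `m`-fold barycentric subdivision of a list of length `n`. -/
noncomputable def iterSubdivide (m n : ℕ) : (List V → ZMod 2) → List V → ZMod 2 :=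
  (subdivide n)^[m]

theorem iterSubdivide_succ (m n : ℕ) (φ : List V → ZMod 2) :
    iterSubdivide (m + 1) n φ = subdivide n (iterSubdivide m n φ) :=
  Function.iterate_succ_apply' _ _ _

theorem iterSubdivide_add (m n : ℕ) (φ ψ : List V → ZMod 2) :
    iterSubdivide m n (fun t => φ t + ψ t) =
      fun t => iterSubdivide m n φ t + iterSubdivide m n ψ t := by
  induction m with
  | zero => rfl
  | succ m ih =>
    funext l
    simp only [iterSubdivide_succ, ih, subdivide_add]

theorem iterSubdivide_comp_neg (m n : ℕ) (φ : List V → ZMod 2) :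
    iterSubdivide m n (fun t => φ (t.map Neg.neg)) =
      fun t => iterSubdivide m n φ (t.map Neg.neg) := by
  induction m with
  | zero => rfl
  | succ m ih =>
    funext l
    simp only [iterSubdivide_succ, ih, subdivide_comp_neg]

theorem iterSubdivide_one_singleton (m : ℕ) (φ : List V → ZMod 2) (v : V) :
    iterSubdivide m 1 φ [v] = φ [v] := by
  induction m with
  | zero => rfl
  | succ m ih => rw [iterSubdivide_succ, subdivide_one_singleton, ih]

theorem iterSubdivide_eq_zero {N : ℕ} {D : ℝ} (m : ℕ) {n : ℕ} (hn : n ≤ N + 1)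
    (φ : List V → ZMod 2) (l : List V) (hl : l.length = n) {K : Set V} (hK : Convex ℝ K)
    (hlK : ∀ x ∈ l, x ∈ K) (hlD : ∀ x ∈ l, ∀ y ∈ l, dist x y ≤ D)
    (h : ∀ t : List V, t.length = n → (∀ x ∈ t, x ∈ K) →
      (∀ x ∈ t, ∀ y ∈ t, dist x y ≤ (N / (N + 1) : ℝ) ^ m * D) → φ t = 0) :
    iterSubdivide m n φ l = 0 := by
  induction m generalizing l D with
  | zero => exact h l hl hlK (by simpa using hlD)
  | succ m ih =>
    rw [iterSubdivide_succ]
    refine subdivide_eq_zero n hn _ l hl K hK hlK hlD fun t ht htK htD => ?_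
    refine ih t ht htK htD fun s hs hsK hsD => h s hs hsK fun x hx y hy => ?_
    rw [pow_succ, mul_assoc]
    exact hsD x hx y hy

theorem iterSubdivide_congr (m n : ℕ) {φ ψ : List V → ZMod 2} {l : List V}
    (hl : l.length = n) {K : Set V} (hK : Convex ℝ K) (hlK : ∀ x ∈ l, x ∈ K)
    (h : ∀ t : List V, t.length = n → (∀ x ∈ t, x ∈ K) → φ t = ψ t) :
    iterSubdivide m n φ l = iterSubdivide m n ψ l := by
  obtain ⟨D, hD⟩ := Metric.isBounded_iff.1 (l.finite_toSet.isBounded)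
  have h0 := iterSubdivide_eq_zero (N := n) m (by omega) (fun t => φ t + ψ t) l hl hK hlK
    (fun x hx y hy => hD hx hy) fun t ht htK _ => by
      rw [h t ht htK, CharTwo.add_self_eq_zero]
  rw [iterSubdivide_add] at h0
  exact CharTwo.add_eq_zero.1 h0

theorem iterSubdivide_coboundary (m n : ℕ) (φ : List V → ZMod 2) (l : List V)
    (hl : l.length = n + 1) :
    iterSubdivide m (n + 1) (coboundary φ) l = coboundary (iterSubdivide m n φ) l := by
  induction m generalizing l with
  | zero => rfl
  | succ m ih =>
    rw [iterSubdivide_succ, iterSubdivide_succ, ← subdivide_coboundary _ _ _ hl]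
    exact iterSubdivide_congr 1 (n + 1) hl convex_univ (by simp) fun t ht _ => ih t ht

end Subdivision

section Crossing

variable {V : Type*}

/-- The cochain `w i ⌣ w (i + 1) ⌣ ⋯` where `w j` is the coboundary of `ε j`. -/
def crossing (ε : ℕ → V → ZMod 2) : ℕ → List V → ZMod 2
  | i, x :: y :: l => (ε i x + ε i y) * crossing ε (i + 1) (y :: l)
  | _, _ => 1

/-- The cochain `w i ⌣ w (i + 1) ⌣ ⋯ ⌣ ε j` where `w j` is the coboundary of `ε j`. -/
def primitive (ε : ℕ → V → ZMod 2) : ℕ → List V → ZMod 2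
  | i, x :: y :: l => (ε i x + ε i y) * primitive ε (i + 1) (y :: l)
  | i, [x] => ε i x
  | _, [] => 0

theorem coboundary_primitive (ε : ℕ → V → ZMod 2) (i : ℕ) (x y : V) (l : List V) :
    coboundary (primitive ε i) (x :: y :: l) = crossing ε i (x :: y :: l) := by
  induction l generalizing i x y with
  | nil => simp [coboundary, primitive, crossing, add_comm]
  | cons z l ih =>
    have h := ih (i + 1) y z
    rw [coboundary_cons] at h
    rw [coboundary_cons, coboundary_cons]
    simp only [primitive, crossing] at h ⊢
    rw [coboundary_const_mul, ← h]
    have h2 : (2 : ZMod 2) = 0 := rfl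
    linear_combination ε i z * primitive ε (i + 1) (z :: l) * h2

theorem crossing_eq_primitive_add [Neg V] {ε : ℕ → V → ZMod 2} {l : List V}
    (hε : ∀ i, ∀ x ∈ l, ε i (-x) = ε i x + 1) (hl : l ≠ []) (i : ℕ) :
    crossing ε i l = primitive ε i l + primitive ε i (l.map Neg.neg) := by
  have h2 : (2 : ZMod 2) = 0 := rfl
  induction l generalizing i with
  | nil => exact absurd rfl hl
  | cons x l ih =>
    cases l with
    | nil =>
      have := hε i x (by simp)
      simp only [crossing, primitive, List.map_cons, List.map_nil, this]
      linear_combination -ε i x * h2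
    | cons y l =>
      have hx := hε i x (by simp)
      have hy := hε i y (by simp)
      have := ih (fun j z hz => hε j z (by simp at hz ⊢; tauto)) (by simp) (i + 1)
      simp only [crossing, primitive, List.map_cons, hx, hy] at this ⊢
      rw [this]
      linear_combination -primitive ε (i + 1) (-y :: List.map Neg.neg l) * h2

theorem exists_ne_of_crossing_ne_zero {ε : ℕ → V → ZMod 2} {l : List V} {i : ℕ}
    (h : crossing ε i l ≠ 0) {j : ℕ} (hj : j + 1 < l.length) :
    ∃ x ∈ l, ∃ y ∈ l, ε (i + j) x ≠ ε (i + j) y := by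
  induction l generalizing i j with
  | nil => simp at hj
  | cons x l ih =>
    cases l with
    | nil => simp at hj
    | cons y l =>
      rw [crossing] at h
      cases j with
      | zero =>
        refine ⟨x, by simp, y, by simp, fun he => left_ne_zero_of_mul h ?_⟩
        rw [add_zero] at he
        rw [he, CharTwo.add_self_eq_zero]
      | succ j =>
        obtain ⟨a, ha, b, hb, hab⟩ := ih (right_ne_zero_of_mul h) (j := j) (by simpa using hj)
        refine ⟨a, by simp [ha], b, by simp [hb], ?_⟩
        rwa [show i + (j + 1) = i + 1 + j by omega]

end Crossing

section CrossPolytope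

variable {V : Type*} [AddCommGroup V]

/-- The sum of a cochain over the facets of the cross-polytope with vertices
`± e 0, …, ± e (k - 1)`. -/
def crossSum (e : ℕ → V) : ℕ → (List V → ZMod 2) → ZMod 2
  | 0, φ => φ []
  | k + 1, φ => crossSum e k (fun t => φ (e k :: t)) + crossSum e k (fun t => φ (-e k :: t))

theorem crossSum_add (e : ℕ → V) (k : ℕ) (φ ψ : List V → ZMod 2) :
    crossSum e k (fun t => φ t + ψ t) = crossSum e k φ + crossSum e k ψ := by
  induction k generalizing φ ψ with
  | zero => rfl
  | succ k ih => simp only [crossSum, ih]; ring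

theorem crossSum_coboundary (e : ℕ → V) (k : ℕ) (φ : List V → ZMod 2) :
    crossSum e k (coboundary φ) = 0 := by
  induction k generalizing φ with
  | zero => rfl
  | succ k ih =>
    simp only [crossSum, coboundary_cons, crossSum_add, ih, add_zero, CharTwo.add_self_eq_zero]

theorem crossSum_comp_neg (e : ℕ → V) (k : ℕ) (φ : List V → ZMod 2) :
    crossSum e k (fun t => φ (t.map Neg.neg)) = crossSum e k φ := by
  induction k generalizing φ with
  | zero => rfl
  | succ k ih =>
    simp only [crossSum, List.map_cons, neg_neg]
    rw [ih fun t => φ (-e k :: t), ih fun t => φ (e k :: t), add_comm]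

/-- `l` lists the vertices of a facet of the cross-polytope with vertices
`± e 0, …, ± e (k - 1)`. -/
def IsCrossFacet [Module ℝ V] (e : ℕ → V) (k : ℕ) (l : List V) : Prop :=
  l.length = k ∧ ∃ s : ℕ → ℝ, (∀ i, s i = 1 ∨ s i = -1) ∧ ∀ v ∈ l, ∃ i < k, v = s i • e i

theorem IsCrossFacet.cons [Module ℝ V] {e : ℕ → V} {k : ℕ} {l : List V} (h : IsCrossFacet e k l)
    {c : ℝ} (hc : c = 1 ∨ c = -1) : IsCrossFacet e (k + 1) (c • e k :: l) := by
  obtain ⟨hl, s, hs, hv⟩ := h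
  refine ⟨by simp [hl], Function.update s k c, fun i => ?_, fun v hvl => ?_⟩
  · rcases eq_or_ne i k with rfl | hi
    · simpa using hc
    · simpa [hi] using hs i
  · rcases List.mem_cons.1 hvl with rfl | hvl
    · exact ⟨k, by omega, by simp⟩
    · obtain ⟨i, hi, rfl⟩ := hv v hvl
      exact ⟨i, by omega, by rw [Function.update_of_ne (by omega)]⟩

theorem crossSum_congr [Module ℝ V] {e : ℕ → V} {k : ℕ} {φ ψ : List V → ZMod 2}
    (h : ∀ l, IsCrossFacet e k l → φ l = ψ l) : crossSum e k φ = crossSum e k ψ := by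
  induction k generalizing φ ψ with
  | zero => exact h [] ⟨rfl, fun _ => 1, fun _ => Or.inl rfl, by simp⟩
  | succ k ih =>
    simp only [crossSum]
    congr 1
    · exact ih fun l hl => h _ (by simpa using hl.cons (c := 1) (by simp))
    · exact ih fun l hl => h _ (by simpa using hl.cons (c := -1) (by simp))

end CrossPolytope

section Main

variable {V : Type*} [NormedAddCommGroup V] [NormedSpace ℝ V]

theorem crossSum_crossing_eq_crossSum_primitive (e : ℕ → V) (ε : ℕ → V → ZMod 2) (m k : ℕ)
    (hk : 0 < k) :
    crossSum e k (fun t => iterSubdivide m (k + 1) (crossing ε 0) (e k :: t)) =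
      crossSum e k (iterSubdivide m k (primitive ε 0)) := by
  have h : ∀ l, IsCrossFacet e k l → iterSubdivide m (k + 1) (crossing ε 0) (e k :: l) =
      iterSubdivide m k (primitive ε 0) l +
        coboundary (fun t => iterSubdivide m k (primitive ε 0) (e k :: t)) l := by
    intro l hl
    have hlen : (e k :: l).length = k + 1 := by simp [hl.1]
    rw [← coboundary_cons, ← iterSubdivide_coboundary _ _ _ _ hlen]
    refine iterSubdivide_congr m (k + 1) hlen convex_univ (by simp) fun t ht _ => ?_
    obtain ⟨x, t, rfl⟩ := List.exists_cons_of_length_eq_add_one ht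
    obtain ⟨y, t, rfl⟩ := List.exists_cons_of_length_pos (l := t) (by simp at ht; omega)
    exact (coboundary_primitive ε 0 x y t).symm
  rw [crossSum_congr h, crossSum_add, crossSum_coboundary, add_zero]

theorem crossSum_primitive_eq_one {A : Set V} {e : ℕ → V} {ε : ℕ → V → ZMod 2} {n : ℕ}
    (hε : ∀ i, ∀ x ∈ A, ε i (-x) = ε i x + 1)
    (hA : ∀ k ≤ n, ∀ l, IsCrossFacet e k l → ∃ K ⊆ A, Convex ℝ K ∧ ∀ x ∈ l, x ∈ K)
    (m k : ℕ) (hk : 0 < k) (hkn : k ≤ n) :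
    crossSum e k (iterSubdivide m k (primitive ε 0)) = 1 := by
  induction k, hk using Nat.le_induction with
  | base =>
    have hfacet : IsCrossFacet e 1 [e 0] :=
      ⟨rfl, fun _ => 1, fun _ => Or.inl rfl, fun v hv => ⟨0, by simp, by simpa using hv⟩⟩
    obtain ⟨K, hKA, -, hK⟩ := hA 1 hkn _ hfacet
    simp only [Nat.succ_eq_add_one, crossSum, zero_add, iterSubdivide_one_singleton,
      primitive, hε 0 (e 0) (hKA (hK _ (by simp)))]
    rw [← add_assoc, CharTwo.add_self_eq_zero, zero_add]
  | succ k hk ih =>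
    rw [← ih (by omega), ← crossSum_crossing_eq_crossSum_primitive e ε m k hk, crossSum,
      ← crossSum_comp_neg e k fun t => iterSubdivide m (k + 1) (primitive ε 0) (-e k :: t),
      ← crossSum_add]
    refine crossSum_congr fun l hl => ?_
    have hl' : IsCrossFacet e (k + 1) (e k :: l) := by simpa using hl.cons (c := 1) (by simp)
    obtain ⟨K, hKA, hK, hlK⟩ := hA (k + 1) hkn _ hl'
    rw [← List.map_cons (f := Neg.neg),
      ← congrFun (iterSubdivide_comp_neg m (k + 1) (primitive ε 0)) (e k :: l),
      ← congrFun (iterSubdivide_add m (k + 1) _ _) (e k :: l)]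
    refine iterSubdivide_congr m (k + 1) hl'.1 hK hlK fun t ht htK => ?_
    exact (crossing_eq_primitive_add (fun i x hx => hε i x (hKA (htK x hx)))
      (List.ne_nil_of_length_pos (by omega)) 0).symm

/-- A combinatorial Borsuk–Ulam theorem: given antipodal two-colourings `ε i` of a bounded set `A`
containing the boundary of a cross-polytope of dimension `n + 1`, some arbitrarily small list of
points of `A` is bichromatic for each of the first `n` of them. -/
theorem exists_small_list_bichromatic {A : Set V} {e : ℕ → V} {ε : ℕ → V → ZMod 2} {n : ℕ}
    (hn : 0 < n) {D : ℝ} (hε : ∀ i, ∀ x ∈ A, ε i (-x) = ε i x + 1)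
    (hA : ∀ k ≤ n + 1, ∀ l, IsCrossFacet e k l →
      ∃ K ⊆ A, Convex ℝ K ∧ ∀ x ∈ l, x ∈ K)
    (hD : ∀ x ∈ A, ∀ y ∈ A, dist x y ≤ D) {δ : ℝ} (hδ : 0 < δ) :
    ∃ l : List V, l ≠ [] ∧ (∀ x ∈ l, x ∈ A) ∧ (∀ x ∈ l, ∀ y ∈ l, dist x y < δ) ∧
      ∀ i < n, ∃ x ∈ l, ∃ y ∈ l, ε i x ≠ ε i y := by
  have hr : (n / (n + 1) : ℝ) < 1 := by rw [div_lt_one (by positivity)]; linarith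
  have hlim := (tendsto_pow_atTop_nhds_zero_of_lt_one (by positivity) hr).mul_const D
  rw [zero_mul] at hlim
  obtain ⟨m, hm⟩ := (hlim.eventually_lt_const hδ).exists
  by_contra! hcon
  have hone : crossSum e n (fun t => iterSubdivide m (n + 1) (crossing ε 0) (e n :: t)) = 1 := by
    rw [crossSum_crossing_eq_crossSum_primitive e ε m n hn]
    exact crossSum_primitive_eq_one hε (fun k hk => hA k hk) m n hn (by omega)
  have hzero : crossSum e n (fun t => iterSubdivide m (n + 1) (crossing ε 0) (e n :: t)) =
      crossSum e n (coboundary fun _ => 0) := by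
    refine crossSum_congr fun l hl => ?_
    have hl' : IsCrossFacet e (n + 1) (e n :: l) := by simpa using hl.cons (c := 1) (by simp)
    obtain ⟨K, hKA, hK, hlK⟩ := hA (n + 1) le_rfl _ hl'
    rw [coboundary_zero]
    refine iterSubdivide_eq_zero (N := n) m le_rfl _ _ hl'.1 hK hlK
      (fun x hx y hy => hD x (hKA (hlK x hx)) y (hKA (hlK y hy))) fun t ht htK htD => ?_
    by_contra hne
    obtain ⟨i, hi, hti⟩ := hcon t (List.ne_nil_of_length_pos (by omega))
      (fun x hx => hKA (htK x hx)) (fun x hx y hy => (htD x hx y hy).trans_lt hm)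
    obtain ⟨x, hx, y, hy, hxy⟩ := exists_ne_of_crossing_ne_zero hne (j := i) (by omega)
    rw [zero_add] at hxy
    exact hxy (hti x hx y hy)
  rw [hone, crossSum_coboundary] at hzero
  exact one_ne_zero hzero

end Main

end ListCochain

/-- Every nonzero vector can be coloured with two colours so that antipodes differ. -/
theorem exists_antipodal_coloring (V : Type*) [AddCommGroup V] [IsAddTorsionFree V] :
    ∃ χ : V → ZMod 2, ∀ x ≠ 0, χ (-x) = χ x + 1 := by
  classical
  refine ⟨fun x => if WellOrderingRel x (-x) then 1 else 0, fun x hx => ?_⟩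
  have hne : x ≠ -x := fun h => hx (self_eq_neg.1 h)
  simp only [neg_neg]
  rcases trichotomous_of WellOrderingRel x (-x) with h | h | h
  · rw [if_pos h, if_neg (asymm h)]; rfl
  · exact absurd h hne
  · rw [if_pos h, if_neg (asymm h)]; rfl

/-- **Borsuk–Ulam theorem.** Any `n` odd real functions on `ℝⁿ⁺¹` that are continuous away from the
origin have a common zero other than the origin. -/
theorem borsuk_ulam {n : ℕ} (f : Fin n → (Fin (n + 1) → ℝ) → ℝ)
    (hf : ∀ i, ContinuousOn (f i) {0}ᶜ) (hodd : ∀ i x, f i (-x) = -f i x) :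
    ∃ x ≠ 0, ∀ i, f i x = 0 := by
  rcases Nat.eq_zero_or_pos n with rfl | hn
  · exact ⟨1, one_ne_zero, fun i => i.elim0⟩
  obtain ⟨χ, hχ⟩ := exists_antipodal_coloring (Fin (n + 1) → ℝ)
  let F : ℕ → (Fin (n + 1) → ℝ) → ℝ := fun i x => if h : i < n then f ⟨i, h⟩ x else 0
  have hFodd : ∀ i x, F i (-x) = -F i x := fun i x => by
    by_cases h : i < n <;> simp [F, h, hodd]
  let ε : ℕ → (Fin (n + 1) → ℝ) → ZMod 2 :=
    fun i x => if 0 < F i x then 1 else if F i x < 0 then 0 else χ x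
  let A : Set (Fin (n + 1) → ℝ) := Metric.closedBall 0 1 \ Metric.ball 0 ((n + 1 : ℝ)⁻¹)
  have hA0 : A ⊆ {0}ᶜ := by
    rintro x ⟨-, hx⟩ rfl
    exact hx (Metric.mem_ball_self (by positivity))
  have hAc : IsCompact A := (isCompact_closedBall _ _).diff Metric.isOpen_ball
  have hε : ∀ i, ∀ x ∈ A, ε i (-x) = ε i x + 1 := by
    intro i x hx
    simp only [ε, hFodd, Left.neg_pos_iff, Left.neg_neg_iff]
    rcases lt_trichotomy (F i x) 0 with h | h | h
    · simp [h, h.not_gt]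
    · simp [h, hχ x (hA0 hx)]
    · simp [h, h.not_gt]; rfl
  let e : ℕ → Fin (n + 1) → ℝ := fun i j => if (j : ℕ) = i then 1 else 0
  have hA : ∀ k ≤ n + 1, ∀ l, ListCochain.IsCrossFacet e k l →
      ∃ K ⊆ A, Convex ℝ K ∧ ∀ x ∈ l, x ∈ K := by
    rintro k hk l ⟨-, s, hs, hl⟩
    let g : (Fin (n + 1) → ℝ) →ₗ[ℝ] ℝ := ∑ i : Fin (n + 1), s i • LinearMap.proj i
    have hg : ∀ x, g x = ∑ i : Fin (n + 1), s i * x i := fun x => by simp [g]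
    refine ⟨Metric.closedBall 0 1 ∩ {x | g x = 1}, ?_,
      (convex_closedBall _ _).inter (convex_hyperplane g.isLinear 1), ?_⟩
    · rintro x ⟨hx, hgx⟩
      refine ⟨hx, fun hx' => ?_⟩
      rw [mem_ball_zero_iff] at hx'
      have h1 : (1 : ℝ) ≤ (n + 1) * ‖x‖ := by
        calc (1 : ℝ) = ‖g x‖ := by rw [show g x = 1 from hgx, norm_one]
          _ ≤ ∑ i : Fin (n + 1), ‖s i * x i‖ := by rw [hg]; exact norm_sum_le _ _
          _ ≤ ∑ _i : Fin (n + 1), ‖x‖ := by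
            refine Finset.sum_le_sum fun i _ => ?_
            rw [norm_mul]
            rcases hs i with h | h <;> simpa [h] using norm_le_pi_norm x i
          _ = (n + 1) * ‖x‖ := by simp
      rw [← one_div, lt_div_iff₀' (by positivity)] at hx'
      linarith
    · intro x hx
      obtain ⟨i, hi, rfl⟩ := hl x hx
      obtain ⟨j, rfl⟩ : ∃ j : Fin (n + 1), (j : ℕ) = i := ⟨⟨i, by omega⟩, rfl⟩
      have hs1 : |s j| = 1 := by rcases hs j with h | h <;> simp [h]
      refine ⟨?_, ?_⟩
      · rw [mem_closedBall_zero_iff, norm_smul, Real.norm_eq_abs, hs1, one_mul,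
          pi_norm_le_iff_of_nonneg zero_le_one]
        intro i
        simp only [e]
        split_ifs <;> simp
      · have : s j * s j = 1 := by rcases hs j with h | h <;> simp [h]
        simp [hg, e, Fin.val_inj, this]
  have hD : ∀ x ∈ A, ∀ y ∈ A, dist x y ≤ 2 := fun x hx y hy => by
    have := dist_triangle_right x y 0
    have h1 := hx.1
    have h2 := hy.1
    rw [Metric.mem_closedBall] at h1 h2
    linarith
  have hsmall : ∀ η > 0, ∃ x ∈ A, ∀ i, |f i x| ≤ η := by
    intro η hη
    have huc : ∀ i, ∃ δ > 0, ∀ x ∈ A, ∀ y ∈ A, dist x y < δ → dist (f i x) (f i y) < η := fun i =>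
      Metric.uniformContinuousOn_iff.1
        (hAc.uniformContinuousOn_of_continuous ((hf i).mono hA0)) η hη
    choose δ hδ0 hδ using huc
    have : Nonempty (Fin n) := ⟨⟨0, hn⟩⟩
    obtain ⟨i₀, hi₀⟩ := Finite.exists_min δ
    obtain ⟨l, hne, hlA, hlδ, hl⟩ := ListCochain.exists_small_list_bichromatic hn hε hA hD (hδ0 i₀)
    obtain ⟨x, hx⟩ := List.exists_mem_of_ne_nil l hne
    refine ⟨x, hlA x hx, fun i => ?_⟩
    obtain ⟨y, hy, z, hz, hyz⟩ := hl i i.2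
    have hFi : ∀ w, F i w = f i w := fun w => by simp [F]
    have hy' := abs_lt.1 (hδ i x (hlA x hx) y (hlA y hy) ((hlδ x hx y hy).trans_le (hi₀ i)))
    have hz' := abs_lt.1 (hδ i x (hlA x hx) z (hlA z hz) ((hlδ x hx z hz).trans_le (hi₀ i)))
    simp only [ε, hFi] at hyz
    rw [abs_le]
    split_ifs at hyz <;> first | exact absurd rfl hyz | constructor <;> linarith
  have hAne : A.Nonempty := (hsmall 1 one_pos).imp fun x hx => hx.1
  have hcont : ContinuousOn (fun x => ∑ i, |f i x|) A :=
    continuousOn_finsetSum _ fun i _ => ((hf i).mono hA0).abs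
  obtain ⟨x, hxA, hmin⟩ := hAc.exists_isMinOn hAne hcont
  refine ⟨x, hA0 hxA, ?_⟩
  have hle : ∑ i, |f i x| ≤ 0 := by
    refine le_of_forall_pos_le_add fun η hη => ?_
    obtain ⟨y, hyA, hy⟩ := hsmall (η / n) (by positivity)
    calc ∑ i, |f i x| ≤ ∑ i, |f i y| := hmin hyA
      _ ≤ ∑ _i : Fin n, η / n := Finset.sum_le_sum fun i _ => hy i
      _ = 0 + η := by simp; field_simp
  intro i
  have h0 := le_antisymm hle (Finset.sum_nonneg fun i _ => abs_nonneg (f i x))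
  simpa using (Finset.sum_eq_zero_iff_of_nonneg fun i _ => abs_nonneg (f i x)).1 h0 i
    (Finset.mem_univ i)

section HamSandwich

variable {E : Type*} [NormedAddCommGroup E] [InnerProductSpace ℝ E]

theorem ae_inner_ne [MeasurableSpace E] [BorelSpace E] [FiniteDimensional ℝ E]
    {u : E} {c : ℝ} (h : u ≠ 0 ∨ c ≠ 0) : ∀ᵐ x : E, ⟪u, x⟫ ≠ c := by
  rcases eq_or_ne u 0 with rfl | hu
  · have hc : c ≠ 0 := h.resolve_left (by simp)
    exact .of_forall fun x => by simpa using hc.symm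
  · have hne : (⟪u, u⟫ : ℝ) ≠ 0 := inner_self_ne_zero.2 hu
    let s : AffineSubspace ℝ E :=
      { carrier := {x | ⟪u, x⟫ = c}
        smul_vsub_vadd_mem' := fun t x y z hx hy hz => by
          simp only [Set.mem_ofPred_eq] at hx hy hz ⊢
          simp [inner_add_right, inner_sub_right, inner_smul_right, hx, hy, hz] }
    refine measure_eq_zero_iff_ae_notMem.1
      (Measure.addHaar_affineSubspace volume s fun htop => ?_)
    have hmem : ∀ x : E, ⟪u, x⟫ = c := fun x => by
      have : x ∈ s := htop ▸ AffineSubspace.mem_top ℝ E x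
      exact this
    have h0 := hmem 0
    rw [inner_zero_right] at h0
    exact hne ((hmem u).trans h0.symm)

/-- The signed difference of the volumes of the two parts of `s` cut out by `{x | ⟪u, x⟫ = c}`. -/
noncomputable def volumeImbalance [MeasurableSpace E] [BorelSpace E] [FiniteDimensional ℝ E]
    (s : Set E) (u : E) (c : ℝ) : ℝ :=
  ∫ x in s, Real.sign (⟪u, x⟫ - c)

variable [MeasurableSpace E] [BorelSpace E] [FiniteDimensional ℝ E]

theorem volumeImbalance_neg (s : Set E) (u : E) (c : ℝ) :
    volumeImbalance s (-u) (-c) = -volumeImbalance s u c := by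
  rw [volumeImbalance, volumeImbalance, ← integral_neg]
  congr with x
  rw [← Real.sign_neg, inner_neg_left]
  congr 1
  ring

theorem measurable_sign_inner_sub (u : E) (c : ℝ) :
    Measurable fun x : E => Real.sign (⟪u, x⟫ - c) := by
  have hm : Measurable fun x : E => ⟪u, x⟫ - c := by fun_prop
  exact Measurable.ite (measurableSet_lt hm measurable_const) measurable_const
    (Measurable.ite (measurableSet_lt measurable_const hm) measurable_const measurable_const)

theorem norm_sign_le_one (r : ℝ) : ‖Real.sign r‖ ≤ 1 := by
  rcases Real.sign_apply_eq r with h | h | h <;> simp [h]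

theorem continuousAt_volumeImbalance {s : Set E} (hs : volume s ≠ ⊤) {p : E × ℝ} (hp : p ≠ 0) :
    ContinuousAt (fun q : E × ℝ => volumeImbalance s q.1 q.2) p := by
  have : IsFiniteMeasure (volume.restrict s) := isFiniteMeasure_restrict.2 hs
  refine continuousAt_of_dominated (bound := fun _ => 1) ?_ ?_ (integrable_const 1) ?_
  · exact .of_forall fun q => (measurable_sign_inner_sub q.1 q.2).aestronglyMeasurable
  · exact .of_forall fun q => .of_forall fun x => norm_sign_le_one _
  · have hnull : ∀ᵐ x : E, ⟪p.1, x⟫ ≠ p.2 := by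
      refine ae_inner_ne ?_
      by_contra! h
      exact hp (Prod.ext h.1 h.2)
    filter_upwards [ae_restrict_of_ae hnull] with x hx
    have hcont : ContinuousAt (fun q : E × ℝ => ⟪q.1, x⟫ - q.2) p := by fun_prop
    refine ContinuousAt.congr (f := fun _ => Real.sign (⟪p.1, x⟫ - p.2)) continuousAt_const ?_
    rcases lt_or_gt_of_ne (sub_ne_zero.2 hx) with h | h
    · filter_upwards [hcont.eventually_lt_const h] with q hq
      rw [Real.sign_of_neg h, Real.sign_of_neg hq]
    · filter_upwards [hcont.eventually_const_lt h] with q hq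
      rw [Real.sign_of_pos h, Real.sign_of_pos hq]

theorem volumeImbalance_eq_sub {s : Set E} (hs : volume s ≠ ⊤) (u : E) (c : ℝ) :
    volumeImbalance s u c =
      volume.real (s ∩ {x | c < ⟪u, x⟫}) - volume.real (s ∩ {x | ⟪u, x⟫ < c}) := by
  have : IsFiniteMeasure (volume.restrict s) := isFiniteMeasure_restrict.2 hs
  have h1 : MeasurableSet {x : E | c < ⟪u, x⟫} :=
    (isOpen_lt (by fun_prop) (by fun_prop)).measurableSet
  have h2 : MeasurableSet {x : E | ⟪u, x⟫ < c} :=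
    (isOpen_lt (by fun_prop) (by fun_prop)).measurableSet
  have hsign : ∀ x : E, Real.sign (⟪u, x⟫ - c) =
      Set.indicator {x : E | c < ⟪u, x⟫} 1 x - Set.indicator {x : E | ⟪u, x⟫ < c} 1 x := by
    intro x
    rcases lt_trichotomy ⟪u, x⟫ c with h | h | h
    · simp [Real.sign_of_neg (sub_neg.2 h), h, h.not_gt]
    · simp [h]
    · simp [Real.sign_of_pos (sub_pos.2 h), h, h.not_gt]
  simp only [volumeImbalance, hsign]
  rw [integral_sub ((integrable_const 1).indicator h1) ((integrable_const 1).indicator h2),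
    integral_indicator_one h1, integral_indicator_one h2, measureReal_restrict_apply h1,
    measureReal_restrict_apply h2, Set.inter_comm s, Set.inter_comm s]

theorem volume_inter_halfspace_eq_half {s : Set E} (hs : volume s ≠ ⊤) {u : E} (hu : u ≠ 0)
    {c : ℝ} (h : volumeImbalance s u c = 0) :
    volume (s ∩ {x | c < ⟪u, x⟫}) = volume s / 2 ∧
      volume (s ∩ {x | ⟪u, x⟫ < c}) = volume s / 2 := by
  have heq : volume (s ∩ {x | c < ⟪u, x⟫}) = volume (s ∩ {x | ⟪u, x⟫ < c}) := by
    rw [volumeImbalance_eq_sub hs, sub_eq_zero] at h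
    exact (measureReal_eq_measureReal_iff (measure_ne_top_of_subset Set.inter_subset_left hs)
      (measure_ne_top_of_subset Set.inter_subset_left hs)).1 h
  have hm : MeasurableSet {x : E | c < ⟪u, x⟫} :=
    (isOpen_lt (by fun_prop) (by fun_prop)).measurableSet
  have hdiff : volume (s \ {x | c < ⟪u, x⟫}) = volume (s ∩ {x | ⟪u, x⟫ < c}) := by
    refine measure_congr ?_
    filter_upwards [ae_inner_ne (c := c) (.inl hu)] with x hx
    refine propext (and_congr_right fun _ => ?_)
    exact not_lt.trans ⟨fun h => lt_of_le_of_ne h hx, le_of_lt⟩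
  have hsum := measure_inter_add_sdiff (μ := volume) s hm
  rw [hdiff, heq, ← two_mul] at hsum
  rw [heq, and_self, ← hsum, mul_comm, ENNReal.mul_div_cancel_right two_ne_zero ENNReal.ofNat_ne_top]

end HamSandwich

/-- **Continuous Ham Sandwich theorem.** Given bounded open sets `U₁, …, U_d` in
`ℝ^d`, there is a hyperplane `{x | ⟪u, x⟫ = c}` such that each of the two open
half-spaces it determines contains exactly half of the volume of each `U_i`. -/
theorem continuous_ham_sandwich (d : ℕ) (hd : 0 < d)
    (U : Fin d → Set (EuclideanSpace ℝ (Fin d)))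
    (hUopen : ∀ i, IsOpen (U i))
    (hUbdd : ∀ i, Bornology.IsBounded (U i)) :
    ∃ (u : EuclideanSpace ℝ (Fin d)) (c : ℝ), u ≠ 0 ∧
      ∀ i : Fin d,
        volume (U i ∩ {x : EuclideanSpace ℝ (Fin d) | c < ⟪u, x⟫}) = volume (U i) / 2 ∧
        volume (U i ∩ {x : EuclideanSpace ℝ (Fin d) | ⟪u, x⟫ < c}) = volume (U i) / 2 := by
  have hfin : ∀ i, volume (U i) ≠ ⊤ := fun i => (hUbdd i).measure_lt_top.ne
  let g : (Fin (d + 1) → ℝ) → EuclideanSpace ℝ (Fin d) × ℝ :=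
    fun p => (WithLp.toLp 2 fun i => p i.castSucc, p (Fin.last d))
  have hgcont : Continuous g := by
    unfold g
    fun_prop
  have hgneg : ∀ p, g (-p) = -g p := fun p => rfl
  have hg0 : ∀ p, g p = 0 → p = 0 := by
    intro p hp
    have h1 : (g p).1 = 0 := congrArg Prod.fst hp
    have h2 : p (Fin.last d) = 0 := congrArg Prod.snd hp
    funext j
    refine Fin.lastCases h2 (fun j => ?_) j
    exact congrArg (fun v : EuclideanSpace ℝ (Fin d) => v j) h1
  obtain ⟨p, hp, hzero⟩ := borsuk_ulam (fun i p => volumeImbalance (U i) (g p).1 (g p).2)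
    (fun i p hp => ((continuousAt_volumeImbalance (hfin i) fun h => hp (hg0 p h)).comp
      (f := g) hgcont.continuousAt).continuousWithinAt)
    (fun i p => by rw [hgneg]; exact volumeImbalance_neg _ _ _)
  rcases eq_or_ne (g p).1 0 with hu | hu
  · have hc : (g p).2 ≠ 0 := fun hc => hp (hg0 p (Prod.ext hu hc))
    have hnull : ∀ i, volume (U i) = 0 := by
      intro i
      have h : volumeImbalance (U i) (g p).1 (g p).2 = 0 := hzero i
      simp only [volumeImbalance, hu, inner_zero_left, zero_sub, setIntegral_const,
        smul_eq_mul, mul_eq_zero, Real.sign_eq_zero_iff, neg_eq_zero, hc, or_false] at h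
      exact (measureReal_eq_zero_iff (hfin i)).1 h
    refine ⟨EuclideanSpace.single ⟨0, hd⟩ 1, 0, by simp, fun i => ?_⟩
    rw [hnull i, ENNReal.zero_div]
    exact ⟨measure_inter_null_of_null_left _ (hnull i), measure_inter_null_of_null_left _ (hnull i)⟩
  · exact ⟨(g p).1, (g p).2, hu, fun i => volume_inter_halfspace_eq_half (hfin i) hu (hzero i)⟩
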